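/- Let p be a real number with p > 2 and let n be a positive integer. Let A be the n×n real matrix with entries a_{ij} = 2p^{i+j} if j > i, a_{ij} = p^{2i} if j = i, and a_{ij} = 0 if j < i. If (x, y) is a Nash equilibrium of the bimatrix game (A, Aᵀ), then x and y have equal supports: {i : x_i > 0} = {j : y_j > 0}. -/

import Mathlib

open Matrix BigOperators

/-- The `n × n` payoff matrix of the paper, with `1`-based indices `i+1, j+1`
for `i j : Fin n`: entry `2 p^{i+j}` above the diagonal, `p^{2i}` on the
diagonal, `0` below it. -/
noncomputable def gameA (p : ℝ) (n : ℕ) : Matrix (Fin n) (Fin n) ℝ :=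
  fun i j =>
    if (i : ℕ) < (j : ℕ) then 2 * p ^ (((i : ℕ) + 1) + ((j : ℕ) + 1))
    else if (i : ℕ) = (j : ℕ) then p ^ (2 * ((i : ℕ) + 1))
    else 0

/-- A mixed strategy: nonnegative components summing to `1`. -/
def IsMixed {I : Type*} [Fintype I] (y : I → ℝ) : Prop :=
  (∀ i, 0 ≤ y i) ∧ ∑ i, y i = 1

/-- `(x, y)` is a Nash equilibrium of the bimatrix game `(A, B)`. -/
def IsNash {I J : Type*} [Fintype I] [Fintype J]
    (A B : Matrix I J ℝ) (x : I → ℝ) (y : J → ℝ) : Prop :=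
  IsMixed x ∧ IsMixed y ∧
  (∀ x' : I → ℝ, IsMixed x' → x' ⬝ᵥ A.mulVec y ≤ x ⬝ᵥ A.mulVec y) ∧
  (∀ y' : J → ℝ, IsMixed y' → x ⬝ᵥ B.mulVec y' ≤ x ⬝ᵥ B.mulVec y)

theorem isMixed_single {I : Type*} [Fintype I] [DecidableEq I] (k : I) :
    IsMixed (Pi.single k (1 : ℝ)) := by
  refine ⟨fun i => ?_, by simp⟩
  by_cases h : i = k
  · subst h; simp
  · simp [h]

/-- A pure strategy in the support of a best response is itself a best response. -/
theorem le_of_pos_of_forall_dotProduct_le {I : Type*} [Fintype I] {x w : I → ℝ}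
    (hx : IsMixed x) (hbest : ∀ x' : I → ℝ, IsMixed x' → x' ⬝ᵥ w ≤ x ⬝ᵥ w)
    {i : I} (hi : 0 < x i) (k : I) : w k ≤ w i := by
  classical
  have hle : ∀ k, w k ≤ x ⬝ᵥ w := fun k => by
    simpa using hbest _ (isMixed_single k)
  have hnonneg : ∀ j ∈ Finset.univ, 0 ≤ x j * (x ⬝ᵥ w - w j) := fun j _ =>
    mul_nonneg (hx.1 j) (sub_nonneg.2 (hle j))
  have hsum : ∑ j, x j * (x ⬝ᵥ w - w j) = 0 := by
    simp only [mul_sub, Finset.sum_sub_distrib]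
    rw [← Finset.sum_mul, hx.2, one_mul]
    exact sub_self _
  have hzero := (Finset.sum_eq_zero_iff_of_nonneg hnonneg).1 hsum i (Finset.mem_univ i)
  have hwi : x ⬝ᵥ w - w i = 0 := (mul_eq_zero.1 hzero).resolve_left hi.ne'
  linarith [hle k]

theorem gameA_nonneg {p : ℝ} (hp : 0 ≤ p) {n : ℕ} (i j : Fin n) : 0 ≤ gameA p n i j := by
  unfold gameA
  split_ifs <;> positivity

/-- Off column `i`, row `i` of the matrix is at most `2 / p` times row `i + 1`. -/
theorem mul_gameA_le {p : ℝ} (hp : 0 ≤ p) {n : ℕ} {i k j : Fin n}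
    (hk : (k : ℕ) = i + 1) (hj : j ≠ i) : p * gameA p n i j ≤ 2 * gameA p n k j := by
  have hji : (j : ℕ) ≠ i := fun h => hj (Fin.ext h)
  rcases lt_or_gt_of_ne hji with h | h
  · have h0 : gameA p n i j = 0 := by
      simp [gameA, h.not_gt, hji.symm]
    rw [h0, mul_zero]
    exact mul_nonneg zero_le_two (gameA_nonneg hp k j)
  · rcases eq_or_ne (j : ℕ) k with hjk | hjk
    · apply le_of_eq
      simp only [gameA, hjk, hk, lt_irrefl, if_true, if_false, Nat.lt_succ_self]
      ring
    · have hkj : (k : ℕ) < j := by omega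
      have hpow : 0 ≤ p * (2 * p ^ (((i : ℕ) + 1) + ((j : ℕ) + 1))) := by positivity
      simp only [gameA, h, hkj, if_true]
      calc p * (2 * p ^ (((i : ℕ) + 1) + ((j : ℕ) + 1)))
          ≤ 2 * (p * (2 * p ^ (((i : ℕ) + 1) + ((j : ℕ) + 1)))) := by linarith
        _ = 2 * (2 * p ^ (((k : ℕ) + 1) + ((j : ℕ) + 1))) := by rw [hk]; ring

/-- Every pure best response to `y` lies in the support of `y`. -/
theorem pos_of_forall_gameA_mulVec_le {p : ℝ} (hp : 2 < p) {n : ℕ} {y : Fin n → ℝ}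
    (hy : IsMixed y) {i : Fin n}
    (hi : ∀ k, (gameA p n).mulVec y k ≤ (gameA p n).mulVec y i) : 0 < y i := by
  have hp0 : 0 < p := by linarith
  by_contra hyi
  have hyi0 : y i = 0 := le_antisymm (not_lt.1 hyi) (hy.1 i)
  have hpos : 0 < (gameA p n).mulVec y i := by
    obtain ⟨j, -, hj⟩ : ∃ j ∈ Finset.univ, 0 < y j :=
      Finset.exists_lt_of_sum_lt (f := fun _ => (0 : ℝ)) (by simp [hy.2])
    refine lt_of_lt_of_le ?_ (hi j)
    refine Finset.sum_pos' (fun l _ => mul_nonneg (gameA_nonneg hp0.le j l) (hy.1 l))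
      ⟨j, Finset.mem_univ j, mul_pos ?_ hj⟩
    simp only [gameA, lt_irrefl, if_true, if_false]
    positivity
  by_cases hn : (i : ℕ) + 1 < n
  · have hrow : p * (gameA p n).mulVec y i ≤ 2 * (gameA p n).mulVec y ⟨i + 1, hn⟩ := by
      simp only [mulVec, dotProduct, Finset.mul_sum, ← mul_assoc]
      refine Finset.sum_le_sum fun j _ => ?_
      rcases eq_or_ne j i with rfl | hj
      · simp [hyi0]
      · exact mul_le_mul_of_nonneg_right (mul_gameA_le hp0.le rfl hj) (hy.1 j)
    nlinarith [hi ⟨i + 1, hn⟩]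
  · refine hpos.ne' ?_
    rw [mulVec, dotProduct]
    refine Finset.sum_eq_zero fun j _ => ?_
    rcases eq_or_ne j i with rfl | hj
    · simp [hyi0]
    · have hji : (j : ℕ) ≠ i := fun h => hj (Fin.ext h)
      have hlt : ¬ (i : ℕ) < j := by omega
      simp [gameA, hlt, hji.symm]

theorem stmt3 (p : ℝ) (hp : 2 < p) (n : ℕ) (hn : 0 < n)
    (x y : Fin n → ℝ) (hxy : IsNash (gameA p n) (gameA p n)ᵀ x y) :
    {i : Fin n | 0 < x i} = {j : Fin n | 0 < y j} := by
  obtain ⟨hx, hy, hbx, hby⟩ := hxy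
  have hby' : ∀ y' : Fin n → ℝ, IsMixed y' →
      y' ⬝ᵥ (gameA p n).mulVec x ≤ y ⬝ᵥ (gameA p n).mulVec x := fun y' hy' => by
    have h := hby y' hy'
    rwa [mulVec_transpose, mulVec_transpose, dotProduct_comm, ← dotProduct_mulVec,
      dotProduct_comm x, ← dotProduct_mulVec] at h
  ext i
  exact ⟨fun hi => pos_of_forall_gameA_mulVec_le hp hy
      (le_of_pos_of_forall_dotProduct_le hx hbx hi),
    fun hi => pos_of_forall_gameA_mulVec_le hp hx
      (le_of_pos_of_forall_dotProduct_le hy hby' hi)⟩
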